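/- Let G₁ and G₂ be strongly connected directed graphs. The Kronecker product graph G₁ ⊗ G₂ is strongly connected and aperiodic if and only if both G₁ and G₂ are aperiodic. -/

import Mathlib

/-- Edge relation of the Kronecker (tensor) product of two directed graphs. -/
def prodRel {V₁ V₂ : Type*} (R₁ : V₁ → V₁ → Prop) (R₂ : V₂ → V₂ → Prop) :
    V₁ × V₂ → V₁ × V₂ → Prop := fun a b => R₁ a.1 b.1 ∧ R₂ a.2 b.2

/-- There is a directed path of length `k` (a sequence of `k` consecutive edges)
from `u` to `v` in the graph with edge relation `R`. -/
def PathOfLength {V : Type*} (R : V → V → Prop) (k : ℕ) (u v : V) : Prop :=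
  ∃ f : ℕ → V, f 0 = u ∧ f k = v ∧ ∀ i < k, R (f i) (f (i + 1))

/-- A directed graph is strongly connected if every vertex reaches every other. -/
def StronglyConnected {V : Type*} (R : V → V → Prop) : Prop :=
  ∀ u v : V, Relation.ReflTransGen R u v

/-- The set of lengths of directed cycles through the vertex `u`. -/
def cycleLengthsAt {V : Type*} (R : V → V → Prop) (u : V) : Set ℕ :=
  {k | 0 < k ∧ PathOfLength R k u u}

/-- The set of lengths of all directed cycles in the graph. -/
def cycleLengths {V : Type*} (R : V → V → Prop) : Set ℕ :=
  {k | 0 < k ∧ ∃ u, PathOfLength R k u u}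

/-- `d` is the greatest common divisor of the set `S` of natural numbers. -/
def IsGcdOfSet (d : ℕ) (S : Set ℕ) : Prop :=
  (∀ k ∈ S, d ∣ k) ∧ ∀ e : ℕ, (∀ k ∈ S, e ∣ k) → e ∣ d

theorem PathOfLength.refl {V : Type*} (R : V → V → Prop) (u : V) : PathOfLength R 0 u u :=
  ⟨fun _ => u, rfl, rfl, fun _ hi => absurd hi (Nat.not_lt_zero _)⟩

theorem PathOfLength.single {V : Type*} {R : V → V → Prop} {u v : V} (h : R u v) :
    PathOfLength R 1 u v := by
  refine ⟨fun i => if i = 0 then u else v, by simp, by simp, fun i hi => ?_⟩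
  obtain rfl : i = 0 := by omega
  simpa using h

theorem PathOfLength.trans {V : Type*} {R : V → V → Prop} {a b : ℕ} {u v w : V}
    (h₁ : PathOfLength R a u v) (h₂ : PathOfLength R b v w) : PathOfLength R (a + b) u w := by
  obtain ⟨f, f0, fa, hf⟩ := h₁
  obtain ⟨g, g0, gb, hg⟩ := h₂
  refine ⟨fun i => if i < a then f i else g (i - a), ?_, by simp [gb], fun i hi => ?_⟩
  · by_cases ha : 0 < a
    · simp [ha, f0]
    · obtain rfl : a = 0 := by omega
      simp [g0, ← fa, f0]
  · rcases lt_trichotomy (i + 1) a with h | h | h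
    · have h' : i < a := by omega
      simpa [h, h'] using hf i h'
    · have h' : i < a := by omega
      have := hf i h'
      rw [h, fa] at this
      simpa [h, h', g0] using this
    · have h₁ : ¬ i < a := by omega
      have h₂ : ¬ i + 1 < a := by omega
      have h₃ : i + 1 - a = i - a + 1 := by omega
      simpa [h₁, h₂, h₃] using hg (i - a) (by omega)

theorem PathOfLength.reflTransGen {V : Type*} {R : V → V → Prop} {k : ℕ} {u v : V}
    (h : PathOfLength R k u v) : Relation.ReflTransGen R u v := by
  obtain ⟨f, rfl, rfl, hf⟩ := h
  have key : ∀ j ≤ k, Relation.ReflTransGen R (f 0) (f j) := by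
    intro j
    induction j with
    | zero => exact fun _ => .refl
    | succ j ih => exact fun hj => (ih (by omega)).tail (hf j (by omega))
  exact key k le_rfl

theorem exists_pathOfLength_of_reflTransGen {V : Type*} {R : V → V → Prop} {u v : V}
    (h : Relation.ReflTransGen R u v) : ∃ k, PathOfLength R k u v := by
  induction h with
  | refl => exact ⟨0, .refl R u⟩
  | tail _ h ih => exact ih.imp' (· + 1) fun _ hk => hk.trans (.single h)

theorem pathOfLength_prodRel_iff {V₁ V₂ : Type*} {R₁ : V₁ → V₁ → Prop} {R₂ : V₂ → V₂ → Prop}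
    {k : ℕ} {u v : V₁ × V₂} :
    PathOfLength (prodRel R₁ R₂) k u v ↔
      PathOfLength R₁ k u.1 v.1 ∧ PathOfLength R₂ k u.2 v.2 := by
  constructor
  · rintro ⟨f, rfl, rfl, hf⟩
    exact ⟨⟨fun i => (f i).1, rfl, rfl, fun i hi => (hf i hi).1⟩,
      ⟨fun i => (f i).2, rfl, rfl, fun i hi => (hf i hi).2⟩⟩
  · rintro ⟨⟨f, f0, fk, hf⟩, ⟨g, g0, gk, hg⟩⟩
    exact ⟨fun i => (f i, g i), Prod.ext f0 g0, Prod.ext fk gk, fun i hi => ⟨hf i hi, hg i hi⟩⟩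

theorem isGcdOfSet_one_iff {S : Set ℕ} :
    IsGcdOfSet 1 S ↔ ∀ e : ℕ, (∀ k ∈ S, e ∣ k) → e ∣ 1 :=
  ⟨fun h => h.2, fun h => ⟨fun k _ => one_dvd k, h⟩⟩

theorem IsGcdOfSet.one_mono {S T : Set ℕ} (h : IsGcdOfSet 1 S) (hST : S ⊆ T) : IsGcdOfSet 1 T :=
  isGcdOfSet_one_iff.2 fun e he => h.2 e fun k hk => he k (hST hk)

theorem StronglyConnected.isGcdOfSet_one_cycleLengthsAt {V : Type*} {R : V → V → Prop}
    (hSC : StronglyConnected R) (h : IsGcdOfSet 1 (cycleLengths R)) (u : V) :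
    IsGcdOfSet 1 (cycleLengthsAt R u) := by
  refine isGcdOfSet_one_iff.2 fun e he => h.2 e ?_
  rintro k ⟨hk, w, hw⟩
  obtain ⟨a, ha⟩ := exists_pathOfLength_of_reflTransGen (hSC u w)
  obtain ⟨b, hb⟩ := exists_pathOfLength_of_reflTransGen (hSC w u)
  have h₁ : e ∣ a + b := by
    rcases Nat.eq_zero_or_pos (a + b) with h0 | h0
    · simp [h0]
    · exact he _ ⟨h0, ha.trans hb⟩
  have h₂ : e ∣ a + b + k := by
    have : e ∣ a + k + b := he _ ⟨by omega, (ha.trans hw).trans hb⟩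
    rwa [Nat.add_right_comm] at this
  exact (Nat.dvd_add_right h₁).1 h₂

/-- In a strongly connected aperiodic graph, any two vertices are joined by paths of every
sufficiently large length. -/
theorem StronglyConnected.exists_forall_ge_pathOfLength {V : Type*} {R : V → V → Prop}
    (hSC : StronglyConnected R) (h : IsGcdOfSet 1 (cycleLengths R)) (u v : V) :
    ∃ N, ∀ k ≥ N, PathOfLength R k u v := by
  obtain ⟨n, hn⟩ := Nat.exists_mem_closure_of_ge (cycleLengthsAt R u)
  obtain ⟨a, ha⟩ := exists_pathOfLength_of_reflTransGen (hSC u v)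
  have hgcd : Nat.setGcd (cycleLengthsAt R u) ∣ 1 :=
    (hSC.isGcdOfSet_one_cycleLengthsAt h u).2 _ fun _ hk => Nat.setGcd_dvd_of_mem hk
  refine ⟨n + a, fun k hk => ?_⟩
  have hmem := hn (k - a) (by omega) (hgcd.trans (one_dvd _))
  have hcycle : PathOfLength R (k - a) u u :=
    AddSubmonoid.closure_induction (fun _ hx => hx.2) (.refl R u)
      (fun _ _ _ _ hx hy => hx.trans hy) hmem
  have := hcycle.trans ha
  rwa [Nat.sub_add_cancel (by omega)] at this

theorem kronecker_product_strongly_connected_aperiodic_iff {V₁ V₂ : Type*}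
    [Nonempty V₁] [Nonempty V₂]
    (R₁ : V₁ → V₁ → Prop) (R₂ : V₂ → V₂ → Prop)
    (hSC₁ : StronglyConnected R₁) (hSC₂ : StronglyConnected R₂) :
    (StronglyConnected (prodRel R₁ R₂) ∧ IsGcdOfSet 1 (cycleLengths (prodRel R₁ R₂))) ↔
      (IsGcdOfSet 1 (cycleLengths R₁) ∧ IsGcdOfSet 1 (cycleLengths R₂)) := by
  constructor
  · rintro ⟨-, h⟩
    exact ⟨h.one_mono fun k ⟨hk, u, hu⟩ => ⟨hk, u.1, (pathOfLength_prodRel_iff.1 hu).1⟩,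
      h.one_mono fun k ⟨hk, u, hu⟩ => ⟨hk, u.2, (pathOfLength_prodRel_iff.1 hu).2⟩⟩
  · rintro ⟨h₁, h₂⟩
    have key : ∀ u v : V₁ × V₂, ∃ N, ∀ k ≥ N, PathOfLength (prodRel R₁ R₂) k u v := by
      intro u v
      obtain ⟨N₁, hN₁⟩ := hSC₁.exists_forall_ge_pathOfLength h₁ u.1 v.1
      obtain ⟨N₂, hN₂⟩ := hSC₂.exists_forall_ge_pathOfLength h₂ u.2 v.2
      exact ⟨N₁ + N₂, fun k hk =>
        pathOfLength_prodRel_iff.2 ⟨hN₁ k (by omega), hN₂ k (by omega)⟩⟩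
    refine ⟨fun u v => ?_, isGcdOfSet_one_iff.2 fun e he => ?_⟩
    · obtain ⟨N, hN⟩ := key u v
      exact (hN N le_rfl).reflTransGen
    · obtain ⟨u⟩ : Nonempty (V₁ × V₂) := inferInstance
      obtain ⟨N, hN⟩ := key u u
      have hd₁ : e ∣ N + 1 := he _ ⟨by omega, u, hN _ (by omega)⟩
      have hd₂ : e ∣ N + 1 + 1 := he _ ⟨by omega, u, hN _ (by omega)⟩
      exact (Nat.dvd_add_right hd₁).1 hd₂
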